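/- Let 𝒯 = (T, σ, 1) be a directed tile assembly system with unique terminal assembly α, let P ∈ P[α] be a simply pumpable path, and let β be a finite producible assembly such that P₀ is a tile of β. Then there exists an index i such that every path growing on pump(P) at an index j ≥ i belongs to P[α]. -/

import Mathlib

/-! ## The abstract tile assembly model at temperature 1 -/

structure Glue where
  label : ℕ
  strength : ℕ
deriving DecidableEq

instance : Inhabited Glue := ⟨⟨0, 0⟩⟩

/-- A tile type: a unit square with a glue on each of its four sides. -/
structure TileType where
  north : Glue
  east : Glue
  south : Glue
  west : Glue
deriving DecidableEq

instance : Inhabited TileType := ⟨⟨default, default, default, default⟩⟩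

/-- Positions of the discrete plane `ℤ²`. -/
abbrev Pos : Type := ℤ × ℤ

/-- A tile is a position together with a tile type. -/
abbrev Tile : Type := Pos × TileType

/-- Two equal glues bind iff their common strength is at least 1. -/
def glueBind (g g' : Glue) : Prop := g = g' ∧ 1 ≤ g.strength

/-- Two tiles interact (bind) if they are at adjacent positions and the glues on
their abutting sides are equal with strength at least 1. -/
def interact (a b : Tile) : Prop :=
  (b.1 = (a.1.1, a.1.2 + 1) ∧ glueBind a.2.north b.2.south) ∨
  (b.1 = (a.1.1 + 1, a.1.2) ∧ glueBind a.2.east b.2.west) ∨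
  (b.1 = (a.1.1, a.1.2 - 1) ∧ glueBind a.2.south b.2.north) ∨
  (b.1 = (a.1.1 - 1, a.1.2) ∧ glueBind a.2.west b.2.east)

/-- An assembly: a partial function from `ℤ²` to tile types. -/
abbrev Assembly : Type := Pos → Option TileType

/-- The domain of an assembly. -/
def adom (α : Assembly) : Set Pos := {p | α p ≠ none}

/-- Translation of an assembly by a vector: `(α + v)(x) = α (x - v)`. -/
def translateA (α : Assembly) (v : Pos) : Assembly := fun p => α (p - v)

/-- Adjacency in `ℤ²`. -/
def adjacent (p q : Pos) : Prop := (p.1 - q.1).natAbs + (p.2 - q.2).natAbs = 1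

/-- The domain of the assembly is a connected subset of `ℤ²`. -/
def ConnectedDom (α : Assembly) : Prop :=
  ∀ p q, p ∈ adom α → q ∈ adom α →
    Relation.ReflTransGen (fun a b => a ∈ adom α ∧ b ∈ adom α ∧ adjacent a b) p q

/-- Two occupied positions of an assembly are bound. -/
def bindsIn (α : Assembly) (p q : Pos) : Prop :=
  ∃ t t', α p = some t ∧ α q = some t' ∧ interact (p, t) (q, t')

/-- Stability at temperature 1: the binding graph is connected (every cut has
weight at least 1). -/
def StableA (α : Assembly) : Prop :=
  ConnectedDom α ∧ ∀ p q, p ∈ adom α → q ∈ adom α → Relation.ReflTransGen (bindsIn α) p q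

/-- `β` is obtained from `α` by the stable binding of a single tile of type from `T`. -/
def Attaches (T : Finset TileType) (α β : Assembly) : Prop :=
  ∃ p t, t ∈ T ∧ α p = none ∧ β p = some t ∧ (∀ q, q ≠ p → β q = α q) ∧
    ∃ q t', α q = some t' ∧ interact (p, t) (q, t')

/-- `α` is producible from the seed `σ`: it is the union of a (possibly infinite)
sequence of single-tile additions starting from `σ`. -/
def Producible (T : Finset TileType) (σ α : Assembly) : Prop :=
  ∃ f : ℕ → Assembly, f 0 = σ ∧
    (∀ n, f (n + 1) = f n ∨ Attaches T (f n) (f (n + 1))) ∧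
    (∀ p t, α p = some t ↔ ∃ n, f n p = some t)

/-- `α` is a terminal assembly of the system `(T, σ, 1)`. -/
def Terminal (T : Finset TileType) (σ α : Assembly) : Prop :=
  Producible T σ α ∧ ∀ β, ¬ Attaches T α β

/-- The seed is an assembly over `T` which is stable at temperature 1. -/
def SeedOk (T : Finset TileType) (σ : Assembly) : Prop :=
  (∀ p t, σ p = some t → t ∈ T) ∧ StableA σ

/-- `α` is `v`-periodic. -/
def PeriodicA (α : Assembly) (v : Pos) : Prop := v ≠ 0 ∧ translateA α v = α

/-- Collinearity of two vectors of `ℤ²`. -/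
def Collin (u v : Pos) : Prop := u.1 * v.2 = u.2 * v.1

/-- `α` is bi-periodic: periodic for two non-collinear vectors. -/
def BiPeriodicA (α : Assembly) : Prop :=
  ∃ u v : Pos, ¬ Collin u v ∧ PeriodicA α u ∧ PeriodicA α v

/-- `α` is simply periodic: periodic but not bi-periodic. -/
def SimplyPeriodicA (α : Assembly) : Prop := (∃ v, PeriodicA α v) ∧ ¬ BiPeriodicA α

/-- `α` is aperiodic. -/
def AperiodicA (α : Assembly) : Prop := ¬ ∃ v, PeriodicA α v

/-- Complexity of an assembly: a finite assembly has complexity 0; for `i ≥ 1` an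
assembly has complexity `i` if it is `⋃_{ℓ ∈ ℕ} (β + ℓ v)` for some `β` of
complexity `i - 1`, or a finite union of assemblies of complexity less than `i`. -/
inductive HasComplexity : Assembly → ℕ → Prop
  | finite (α : Assembly) (h : (adom α).Finite) : HasComplexity α 0
  | pump (i : ℕ) (β : Assembly) (v : Pos) (α : Assembly) (hβ : HasComplexity β i)
      (hα : ∀ p t, α p = some t ↔ ∃ ℓ : ℕ, β (p - (ℓ : ℤ) • v) = some t) :
      HasComplexity α (i + 1)
  | union (i n : ℕ) (f : Fin n → Assembly) (c : Fin n → ℕ) (hc : ∀ k, c k ≤ i)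
      (hf : ∀ k, HasComplexity (f k) (c k)) (α : Assembly)
      (hα : ∀ p t, α p = some t ↔ ∃ k, f k p = some t) :
      HasComplexity α (i + 1)

/-! ## Paths -/

/-- A (finite, nonempty) path: a sequence of tiles with pairwise distinct positions
in which each consecutive pair of tiles interacts. -/
def IsPath (P : List Tile) : Prop :=
  P ≠ [] ∧ List.Chain' interact P ∧ (P.map Prod.fst).Nodup

/-- `P` is a path of `α`: `asm(P)` is a subassembly of `α`. -/
def PathIn (α : Assembly) (P : List Tile) : Prop :=
  IsPath P ∧ ∀ a ∈ P, α a.1 = some a.2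

/-- Translation of a tile. -/
def tTile (a : Tile) (w : Pos) : Tile := (a.1 + w, a.2)

/-- Translation of a path. -/
def translatePath (P : List Tile) (w : Pos) : List Tile := P.map (fun a => tTile a w)

/-- The `i`-th tile of a finite path. -/
def nth (P : List Tile) (i : ℕ) : Tile := P.getD i default

/-- The vector `pos(P_{|P|-1}) - pos(P₀)` of a finite path. -/
def pathVec (P : List Tile) : Pos := (nth P (P.length - 1)).1 - (nth P 0).1

/-- `P_{k mod (|P|-1)} + ⌊k / (|P|-1)⌋ • pathVec P`. -/
def pumpTile (P : List Tile) (k : ℤ) : Tile :=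
  tTile (nth P ((k % ((P.length : ℤ) - 1)).toNat)) ((k / ((P.length : ℤ) - 1)) • pathVec P)

/-- The pumping of `P`: an infinite sequence of tiles indexed by `ℕ`. -/
def pump (P : List Tile) (k : ℕ) : Tile := pumpTile P k

/-- The bi-pumping of `P`: a bi-infinite sequence of tiles indexed by `ℤ`. -/
def bipump (P : List Tile) (k : ℤ) : Tile := pumpTile P k

/-- `P` is a good candidate: `type(P₀) = type(P_{|P|-1})` and the only intersection
between `P` and `P + pathVec P` is the agreement of `P₀ + pathVec P` with `P_{|P|-1}`. -/
def GoodCandidate (P : List Tile) : Prop :=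
  2 ≤ P.length ∧ (nth P 0).2 = (nth P (P.length - 1)).2 ∧
  ∀ i j, i < P.length → j < P.length → (nth P i).1 + pathVec P = (nth P j).1 →
    i = 0 ∧ j = P.length - 1

/-- A one-way infinite path. -/
def IsInfPath (Q : ℕ → Tile) : Prop :=
  (∀ k, interact (Q k) (Q (k + 1))) ∧ Function.Injective fun k => (Q k).1

/-- A bi-infinite path. -/
def IsBiPath (Q : ℤ → Tile) : Prop :=
  (∀ k : ℤ, interact (Q k) (Q (k + 1))) ∧ Function.Injective fun k => (Q k).1

/-- A one-way infinite path of `α`. -/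
def InfPathIn (α : Assembly) (Q : ℕ → Tile) : Prop :=
  IsInfPath Q ∧ ∀ k, α (Q k).1 = some (Q k).2

/-- A bi-infinite path of `α`. -/
def BiPathIn (α : Assembly) (Q : ℤ → Tile) : Prop :=
  IsBiPath Q ∧ ∀ k, α (Q k).1 = some (Q k).2

/-- A good candidate `P` is pumpable (with respect to the terminal assembly `α`)
if `pump P ∈ P[α]`. -/
def Pumpable (α : Assembly) (P : List Tile) : Prop :=
  GoodCandidate P ∧ InfPathIn α (pump P)

/-- A good candidate `P` is bi-pumpable if `bipump P ∈ P[α]`. -/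
def BiPumpable (α : Assembly) (P : List Tile) : Prop :=
  GoodCandidate P ∧ BiPathIn α (bipump P)

/-- Simply pumpable: pumpable but not bi-pumpable. -/
def SimplyPumpable (α : Assembly) (P : List Tile) : Prop :=
  Pumpable α P ∧ ¬ BiPumpable α P

/-- A path without redundancy: two tiles share a tile type only if they are the
two extremities. -/
def NoRedundancy (P : List Tile) : Prop :=
  ∀ i j, i < j → j < P.length → (nth P i).2 = (nth P j).2 → i = 0 ∧ j = P.length - 1

/-- The single-tile assembly consisting of the tile `a`. -/
def singleTile (a : Tile) : Assembly := fun p => if p = a.1 then some a.2 else none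

/-- `Q` grows on the infinite path `R` at index `i`: the only intersection of `Q`
with `R` is at `pos(Q₀) = pos(R_i)` and is an agreement. -/
def GrowsOnPump (Q : List Tile) (R : ℕ → Tile) (i : ℕ) : Prop :=
  IsPath Q ∧ nth Q 0 = R i ∧
  ∀ k m, k < Q.length → (nth Q k).1 = (R m).1 → k = 0 ∧ m = i

/-- `Q` is an arc of the infinite path `R` between indices `i ≠ j`: the only
intersections of `Q` with `R` are agreements at its two extremities. -/
def IsArcOfPump (Q : List Tile) (R : ℕ → Tile) (i j : ℕ) : Prop :=
  IsPath Q ∧ i ≠ j ∧ nth Q 0 = R i ∧ nth Q (Q.length - 1) = R j ∧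
  (∀ k m, k < Q.length → (nth Q k).1 = (R m).1 →
    (k = 0 ∧ m = i) ∨ (k = Q.length - 1 ∧ m = j)) ∧
  (Q.length = 2 → j ≠ i + 1 ∧ i ≠ j + 1)

/-- `Q` is `v`-self-avoiding with respect to `α`: `Q` never intersects `Q + ℓ v` for
`ℓ ≥ 1`, and all large enough translations `Q + ℓ v` are paths of `α`. -/
def VSelfAvoiding (α : Assembly) (Q : List Tile) (v : Pos) : Prop :=
  (∀ ℓ : ℕ, 1 ≤ ℓ → ∀ a ∈ Q, ∀ b ∈ Q, a.1 ≠ b.1 + (ℓ : ℤ) • v) ∧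
  ∃ L : ℕ, ∀ ℓ : ℕ, L ≤ ℓ → PathIn α (translatePath Q ((ℓ : ℤ) • v))

/-! ## Auxiliary results -/

theorem interact_symm {a b : Tile} (h : interact a b) : interact b a := by
  obtain ⟨⟨a1, a2⟩, ta⟩ := a
  obtain ⟨⟨b1, b2⟩, tb⟩ := b
  simp only [interact, glueBind, Prod.mk.injEq] at h ⊢
  rcases h with ⟨⟨h1, h2⟩, h3, h4⟩ | ⟨⟨h1, h2⟩, h3, h4⟩ | ⟨⟨h1, h2⟩, h3, h4⟩ | ⟨⟨h1, h2⟩, h3, h4⟩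
  · exact Or.inr (Or.inr (Or.inl ⟨⟨by omega, by omega⟩, h3.symm, h3 ▸ h4⟩))
  · exact Or.inr (Or.inr (Or.inr ⟨⟨by omega, by omega⟩, h3.symm, h3 ▸ h4⟩))
  · exact Or.inl ⟨⟨by omega, by omega⟩, h3.symm, h3 ▸ h4⟩
  · exact Or.inr (Or.inl ⟨⟨by omega, by omega⟩, h3.symm, h3 ▸ h4⟩)

theorem interact_translate {a b : Tile} (w : Pos) (h : interact a b) :
    interact (tTile a w) (tTile b w) := by
  obtain ⟨⟨a1, a2⟩, ta⟩ := a
  obtain ⟨⟨b1, b2⟩, tb⟩ := b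
  obtain ⟨w1, w2⟩ := w
  simp only [interact, tTile, Prod.mk.injEq, Prod.mk_add_mk] at h ⊢
  rcases h with ⟨⟨h1, h2⟩, h3⟩ | ⟨⟨h1, h2⟩, h3⟩ | ⟨⟨h1, h2⟩, h3⟩ | ⟨⟨h1, h2⟩, h3⟩
  · exact Or.inl ⟨⟨by omega, by omega⟩, h3⟩
  · exact Or.inr (Or.inl ⟨⟨by omega, by omega⟩, h3⟩)
  · exact Or.inr (Or.inr (Or.inl ⟨⟨by omega, by omega⟩, h3⟩))
  · exact Or.inr (Or.inr (Or.inr ⟨⟨by omega, by omega⟩, h3⟩))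

theorem interact_sub_mem {a b : Tile} (h : interact a b) :
    a.1 - b.1 ∈ (Set.Icc (-1) 1 ×ˢ Set.Icc (-1) 1 : Set Pos) := by
  obtain ⟨⟨a1, a2⟩, ta⟩ := a
  obtain ⟨⟨b1, b2⟩, tb⟩ := b
  simp only [interact, Prod.mk.injEq] at h
  simp only [Prod.mk_sub_mk, Set.mem_prod, Set.mem_Icc]
  omega

theorem bindsIn_symm {α : Assembly} {p q : Pos} (h : bindsIn α p q) : bindsIn α q p := by
  obtain ⟨t, t', h1, h2, h3⟩ := h
  exact ⟨t', t, h2, h1, interact_symm h3⟩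

theorem Producible.of_attaches {T : Finset TileType} {σ γ τ : Assembly}
    (h : Attaches T σ γ) (hτ : Producible T γ τ) : Producible T σ τ := by
  obtain ⟨f, h0, hs, hl⟩ := hτ
  refine ⟨fun n => Nat.casesOn n σ f, rfl, ?_, ?_⟩
  · rintro (_ | n)
    · right
      simpa [h0] using h
    · exact hs n
  · intro p t
    rw [hl]
    constructor
    · rintro ⟨n, hn⟩
      exact ⟨n + 1, hn⟩
    · rintro ⟨_ | n, hn⟩
      · refine ⟨0, ?_⟩
        obtain ⟨q, u, -, hq, -, hu, -⟩ := h
        rw [h0, hu p ?_]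
        · exact hn
        · rintro rfl
          simp_all
      · exact ⟨n, hn⟩

theorem Producible.of_reflTransGen {T : Finset TileType} {σ γ τ : Assembly}
    (h : Relation.ReflTransGen (Attaches T) σ γ) (hτ : Producible T γ τ) :
    Producible T σ τ := by
  induction h using Relation.ReflTransGen.head_induction_on with
  | refl => exact hτ
  | head h _ ih => exact ih.of_attaches h

theorem subassembly_of_steps {T : Finset TileType} {f : ℕ → Assembly}
    (hs : ∀ n, f (n + 1) = f n ∨ Attaches T (f n) (f (n + 1))) {m n : ℕ} (hmn : m ≤ n)
    {p : Pos} {t : TileType} (h : f m p = some t) : f n p = some t := by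
  induction n, hmn using Nat.le_induction with
  | base => exact h
  | succ n _ ih =>
    rcases hs n with he | ⟨q, u, -, hq, -, hu, -⟩
    · rw [he, ih]
    · rw [hu p ?_, ih]
      rintro rfl
      simp_all

theorem exists_producible_terminal (T : Finset TileType) (γ : Assembly) :
    ∃ τ, Terminal T γ τ ∧ ∀ p t, γ p = some t → τ p = some t := by
  classical
  rcases T.eq_empty_or_nonempty with rfl | ⟨t₀, ht₀⟩
  · refine ⟨γ, ⟨⟨fun _ => γ, rfl, fun n => Or.inl rfl, by simp⟩, ?_⟩, fun p t h => h⟩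
    rintro β ⟨p, t, ht, -⟩
    simp at ht
  have : Nonempty (Pos × T) := ⟨(0, ⟨t₀, ht₀⟩)⟩
  obtain ⟨e, he⟩ := exists_surjective_nat (Pos × T)
  let upd : Assembly → Pos × T → Assembly := fun δ c => Function.update δ c.1 (some c.2.1)
  let step : Assembly → Pos × T → Assembly := fun δ c =>
    if Attaches T δ (upd δ c) then upd δ c else δ
  obtain ⟨f, hf0, hf⟩ : ∃ f : ℕ → Assembly, f 0 = γ ∧
      ∀ n, f (n + 1) = step (f n) (e n.unpair.1) :=
    ⟨fun n => Nat.rec γ (fun n δ => step δ (e n.unpair.1)) n, rfl, fun n => rfl⟩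
  have hs : ∀ n, f (n + 1) = f n ∨ Attaches T (f n) (f (n + 1)) := by
    intro n
    rw [hf]
    by_cases h : Attaches T (f n) (upd (f n) (e n.unpair.1))
    · right
      simpa only [step, if_pos h] using h
    · left
      simp only [step, if_neg h]
  have hlim : ∀ p, ∃ o : Option TileType, ∀ t, o = some t ↔ ∃ n, f n p = some t := by
    intro p
    by_cases h : ∃ (t : TileType) (n : ℕ), f n p = some t
    · obtain ⟨u, m, hm⟩ := h
      refine ⟨some u, fun t => ⟨fun h2 => ⟨m, by rw [hm, h2]⟩, ?_⟩⟩
      rintro ⟨n, hn⟩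
      have a1 := subassembly_of_steps hs (le_max_left m n) hm
      have a2 := subassembly_of_steps hs (le_max_right m n) hn
      rw [← a1, a2]
    · refine ⟨none, fun t => ⟨by simp, ?_⟩⟩
      rintro ⟨n, hn⟩
      exact absurd ⟨t, n, hn⟩ h
  choose τ hτ using hlim
  refine ⟨τ, ⟨⟨f, hf0, hs, hτ⟩, ?_⟩, fun p t h => (hτ p t).2 ⟨0, by rw [hf0, h]⟩⟩
  rintro β ⟨p, t, ht, hp, -, -, q, t', hq, hi⟩
  obtain ⟨N, hN⟩ := (hτ q t').1 hq
  obtain ⟨c, hc⟩ := he (p, ⟨t, ht⟩)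
  have hn : N ≤ Nat.pair c N := Nat.right_le_pair c N
  have hnone : ∀ n, f n p = none := by
    intro n
    rw [Option.eq_none_iff_forall_ne_some]
    intro u hu
    rw [(hτ p u).2 ⟨n, hu⟩] at hp
    simp at hp
  have hatt : Attaches T (f (Nat.pair c N)) (upd (f (Nat.pair c N)) (p, ⟨t, ht⟩)) :=
    ⟨p, t, ht, hnone _, by simp [upd], fun q hq => by simp [upd, hq], q, t',
      subassembly_of_steps hs hn hN, hi⟩
  have h1 : f (Nat.pair c N + 1) p = some t := by
    rw [hf, Nat.unpair_pair, hc]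
    simp only [step, if_pos hatt]
    simp [upd]
  rw [hnone] at h1
  simp at h1

/-- `D` is the domain of an assembly obtained from `σ` by finitely many attachments. -/
def Built (T : Finset TileType) (σ : Assembly) (D : Set Pos) : Prop :=
  ∃ γ, Relation.ReflTransGen (Attaches T) σ γ ∧ adom γ = D

theorem mem_adom_iff {α : Assembly} {p : Pos} : p ∈ adom α ↔ ∃ t, α p = some t := by
  simp [adom, Option.ne_none_iff_exists']

section Directed

variable {T : Finset TileType} {σ α : Assembly}

theorem subassembly_of_reflTransGen (huniq : ∀ β, Terminal T σ β → β = α) {γ : Assembly}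
    (h : Relation.ReflTransGen (Attaches T) σ γ) {p : Pos} {t : TileType}
    (hp : γ p = some t) : α p = some t := by
  obtain ⟨τ, ⟨h1, h2⟩, h3⟩ := exists_producible_terminal T γ
  rw [← huniq τ ⟨h1.of_reflTransGen h, h2⟩]
  exact h3 p t hp

theorem Built.attach (huniq : ∀ β, Terminal T σ β → β = α) {D : Set Pos}
    (hD : Built T σ D) {p q : Pos} {t t' : TileType} (hp : p ∉ D) (hq : q ∈ D) (ht : t ∈ T)
    (hqt : α q = some t') (hi : interact (p, t) (q, t')) :
    α p = some t ∧ Built T σ (insert p D) := by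
  classical
  obtain ⟨γ, hγ, rfl⟩ := hD
  have hpn : γ p = none := by simpa [adom] using hp
  obtain ⟨u, hu⟩ := mem_adom_iff.1 hq
  have hut : u = t' := by
    have := subassembly_of_reflTransGen huniq hγ hu
    rw [hqt] at this
    simpa using this.symm
  subst hut
  have hatt : Attaches T γ (Function.update γ p (some t)) :=
    ⟨p, t, ht, hpn, by simp, fun q hq => by simp [hq], q, u, hu, hi⟩
  refine ⟨subassembly_of_reflTransGen huniq (hγ.tail hatt) (by simp), _, hγ.tail hatt, ?_⟩
  ext x
  by_cases hx : x = p
  · simp [adom, hx]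
  · simp [adom, hx]

theorem mem_of_reflTransGen (hseed : SeedOk T σ) {γ : Assembly}
    (h : Relation.ReflTransGen (Attaches T) σ γ) :
    ∀ p t, γ p = some t → t ∈ T := by
  induction h with
  | refl => exact hseed.1
  | tail _ h ih =>
    obtain ⟨q, u, hu, -, hq, ho, -⟩ := h
    intro p t hp
    by_cases hpq : p = q
    · subst hpq
      rw [hq] at hp
      simp at hp
      exact hp ▸ hu
    · rw [ho p hpq] at hp
      exact ih p t hp

theorem reflTransGen_of_steps {f : ℕ → Assembly} (h0 : f 0 = σ)
    (hs : ∀ n, f (n + 1) = f n ∨ Attaches T (f n) (f (n + 1))) (n : ℕ) :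
    Relation.ReflTransGen (Attaches T) σ (f n) := by
  induction n with
  | zero => rw [h0]
  | succ n ih =>
    rcases hs n with h | h
    · rwa [h]
    · exact ih.tail h

theorem Producible.mem_tileset (hseed : SeedOk T σ) (hα : Producible T σ α) {p : Pos}
    {t : TileType} (h : α p = some t) : t ∈ T := by
  obtain ⟨f, h0, hs, hl⟩ := hα
  obtain ⟨n, hn⟩ := (hl p t).1 h
  exact mem_of_reflTransGen hseed (reflTransGen_of_steps h0 hs n) p t hn

theorem Producible.reflTransGen_of_finite {β : Assembly} (hβ : Producible T σ β)
    (hfin : (adom β).Finite) : Relation.ReflTransGen (Attaches T) σ β := by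
  obtain ⟨f, h0, hs, hl⟩ := hβ
  have key : ∀ p ∈ adom β, ∀ᶠ n in Filter.atTop, f n p = β p := by
    intro p hp
    obtain ⟨t, ht⟩ := mem_adom_iff.1 hp
    obtain ⟨n, hn⟩ := (hl p t).1 ht
    filter_upwards [Filter.eventually_ge_atTop n] with m hm
    rw [subassembly_of_steps hs hm hn, ht]
  obtain ⟨N, hN⟩ := ((Filter.eventually_all_finite hfin).2 key).exists
  have : f N = β := by
    funext p
    by_cases hp : p ∈ adom β
    · exact hN p hp
    · have hn : β p = none := by simpa [adom] using hp
      rw [hn, Option.eq_none_iff_forall_ne_some]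
      intro u hu
      rw [(hl p u).2 ⟨N, hu⟩] at hn
      simp at hn
  rw [← this]
  exact reflTransGen_of_steps h0 hs N

theorem bindsIn_connected (hseed : SeedOk T σ) {γ : Assembly}
    (h : Relation.ReflTransGen (Attaches T) σ γ) :
    ∀ p q, p ∈ adom γ → q ∈ adom γ → Relation.ReflTransGen (bindsIn γ) p q := by
  induction h with
  | refl => exact hseed.2.2
  | @tail δ ε _ h ih =>
    obtain ⟨x, u, -, hx, hxu, ho, y, t', hy, hi⟩ := h
    have hsub : ∀ p t, δ p = some t → ε p = some t := by
      intro p t hp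
      rw [ho p, hp]
      rintro rfl
      simp_all
    have hb : ∀ p q, bindsIn δ p q → bindsIn ε p q := by
      rintro p q ⟨t, t', h1, h2, h3⟩
      exact ⟨t, t', hsub _ _ h1, hsub _ _ h2, h3⟩
    have hxy : bindsIn ε x y := ⟨u, t', hxu, hsub _ _ hy, hi⟩
    have hyδ : y ∈ adom δ := mem_adom_iff.2 ⟨t', hy⟩
    have hδ : ∀ p, p ∈ adom ε → p ≠ x → p ∈ adom δ := by
      intro p hp hpx
      simpa only [adom, Set.mem_ofPred_eq, ho p hpx] using hp
    have to_y : ∀ p, p ∈ adom ε →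
        Relation.ReflTransGen (bindsIn ε) p y ∧ Relation.ReflTransGen (bindsIn ε) y p := by
      intro p hp
      by_cases hpx : p = x
      · subst hpx
        exact ⟨.single hxy, .single (bindsIn_symm hxy)⟩
      · exact ⟨Relation.ReflTransGen.mono hb _ _ (ih p y (hδ p hp hpx) hyδ),
          Relation.ReflTransGen.mono hb _ _ (ih y p hyδ (hδ p hp hpx))⟩
    intro p q hp hq
    exact (to_y p hp).1.trans (to_y q hq).2

theorem Built.insert_of_bindsIn (huniq : ∀ β, Terminal T σ β → β = α)
    (hT : ∀ p t, α p = some t → t ∈ T) {D : Set Pos} (hD : Built T σ D) {p q : Pos}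
    (hq : q ∈ D) (h : bindsIn α q p) : Built T σ (insert p D) := by
  by_cases hp : p ∈ D
  · rwa [Set.insert_eq_of_mem hp]
  · obtain ⟨t, t', h1, h2, h3⟩ := h
    exact (hD.attach huniq hp hq (hT _ _ h2) h1 (interact_symm h3)).2

theorem Built.union_chain (huniq : ∀ β, Terminal T σ β → β = α)
    (hT : ∀ p t, α p = some t → t ∈ T) {D : Set Pos} (hD : Built T σ D) (f : ℕ → Pos)
    (N : ℕ) (h0 : f 0 ∈ D) (hf : ∀ i < N, bindsIn α (f i) (f (i + 1))) :
    Built T σ (D ∪ {p | ∃ i ≤ N, p = f i}) := by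
  induction N with
  | zero =>
    convert hD using 1
    ext p
    simp only [Set.mem_union, Set.mem_ofPred_eq]
    constructor
    · rintro (h | ⟨i, hi, rfl⟩)
      · exact h
      · obtain rfl : i = 0 := by omega
        exact h0
    · exact Or.inl
  | succ N ih =>
    have h1 := (ih fun i hi => hf i (by omega)).insert_of_bindsIn huniq hT
      (Or.inr ⟨N, le_rfl, rfl⟩) (hf N (by omega))
    convert h1 using 1
    ext p
    simp only [Set.mem_union, Set.mem_ofPred_eq, Set.mem_insert_iff]
    constructor
    · rintro (h | ⟨i, hi, rfl⟩)
      · exact Or.inr (Or.inl h)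
      · rcases Nat.lt_or_ge i (N + 1) with h | h
        · exact Or.inr (Or.inr ⟨i, by omega, rfl⟩)
        · obtain rfl : i = N + 1 := by omega
          exact Or.inl rfl
    · rintro (rfl | h | ⟨i, hi, rfl⟩)
      · exact Or.inr ⟨N + 1, le_rfl, rfl⟩
      · exact Or.inl h
      · exact Or.inr ⟨i, by omega, rfl⟩

/-- If a translate of `β` conflicts with `α`, then it does so at a position which is occupied
whenever the translate of `p₀` is. -/
theorem exists_forced_conflict (huniq : ∀ β, Terminal T σ β → β = α)
    (hT : ∀ p t, α p = some t → t ∈ T) {β : Assembly} (hβT : ∀ p t, β p = some t → t ∈ T)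
    (w p₀ y : Pos) (hp₀ : α (p₀ + w) = β p₀)
    (hy : Relation.ReflTransGen (bindsIn β) p₀ y) (hconf : α (y + w) ≠ β y) :
    ∃ x ∈ adom β, α (x + w) ≠ β x ∧ ∀ D, Built T σ D → p₀ + w ∈ D → x + w ∈ D := by
  by_contra hno
  push Not at hno
  suffices H : α (y + w) = β y ∧ ∀ D, Built T σ D → p₀ + w ∈ D →
      ∃ D', Built T σ D' ∧ y + w ∈ D' ∧ ∀ d, d + w ∈ D' → d + w ∈ D ∨ α (d + w) = β d from
    hconf H.1
  clear hconf
  induction hy with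
  | refl => exact ⟨hp₀, fun D hD h => ⟨D, hD, h, fun d hd => Or.inl hd⟩⟩
  | @tail y z _ hyz ih =>
    obtain ⟨h1, h2⟩ := ih
    obtain ⟨t, t', hyt, hzt, hi⟩ := hyz
    have hyt' : α (y + w) = some t := h1.trans hyt
    have hiw : interact (y + w, t) (z + w, t') := interact_translate w hi
    by_cases hz : α (z + w) = β z
    · refine ⟨hz, fun D hD h => ?_⟩
      obtain ⟨D', hD', hyD', hsub⟩ := h2 D hD h
      refine ⟨insert (z + w) D', hD'.insert_of_bindsIn huniq hT hyD'
        ⟨t, t', hyt', hz.trans hzt, hiw⟩, Set.mem_insert _ _, ?_⟩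
      rintro d (hd | hd)
      · right
        rwa [add_right_cancel hd]
      · exact hsub d hd
    · exfalso
      obtain ⟨D, hD, hp₀D, hzD⟩ := hno z (mem_adom_iff.2 ⟨t', hzt⟩) hz
      obtain ⟨D', hD', hyD', hsub⟩ := h2 D hD hp₀D
      have hzD' : z + w ∉ D' := fun h => (hsub z h).elim hzD hz
      exact hz (((hD'.attach huniq hzD' hyD' (hβT _ _ hzt) hyt'
        (interact_symm hiw)).1).trans hzt.symm)

end Directed

/-- There is a path of `α` from `(f j).1` to `y` whose only intersection with `f` is at `j`. -/
def Returns (α : Assembly) (f : ℤ → Tile) (y : Pos) (j : ℕ) : Prop :=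
  ∃ (q : ℕ → Tile) (K : ℕ), q 0 = f j ∧ (∀ i < K, interact (q i) (q (i + 1))) ∧
    (∀ i ≤ K, α (q i).1 = some (q i).2) ∧
    (∀ i ≤ K, ∀ m : ℕ, (q i).1 = (f m).1 → m = j) ∧ (q K).1 = y

theorem not_frequently_returns {T : Finset TileType} {σ α : Assembly}
    (hseed : SeedOk T σ) (huniq : ∀ β, Terminal T σ β → β = α)
    (hT : ∀ p t, α p = some t → t ∈ T)
    {β : Assembly} (hβ : Relation.ReflTransGen (Attaches T) σ β) (hfin : (adom β).Finite)
    (f : ℤ → Tile) (n : ℕ) (hn : 0 < n) (v : Pos)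
    (hper : ∀ k l : ℤ, f (k + l * n) = tTile (f k) (l • v))
    (hint : ∀ k, interact (f k) (f (k + 1))) (hinj : Function.Injective fun k => (f k).1)
    (hpos : ∀ k : ℕ, α (f k).1 = some (f k).2)
    (hneg : ∃ k : ℤ, α (f k).1 ≠ some (f k).2)
    (h0 : β (f 0).1 = some (f 0).2) (y : Pos)
    (hfreq : ∃ᶠ j in Filter.atTop, Returns α f y j) : False := by
  have hβα : ∀ p t, β p = some t → α p = some t :=
    fun p t h => subassembly_of_reflTransGen huniq hβ h
  have hβT : ∀ p t, β p = some t → t ∈ T := fun p t h => hT p t (hβα p t h)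
  have hBβ : Built T σ (adom β) := ⟨β, hβ, rfl⟩
  have h0D : (f 0).1 ∈ adom β := mem_adom_iff.2 ⟨_, h0⟩
  have hfT : ∀ k, (f k).2 ∈ T := by
    intro k
    have h1 := hper k k.natAbs
    have h2 : 0 ≤ k + (k.natAbs : ℤ) * n := by
      have : (k.natAbs : ℤ) * 1 ≤ k.natAbs * n := by
        apply mul_le_mul_of_nonneg_left <;> omega
      omega
    obtain ⟨m, hm⟩ := Int.eq_ofNat_of_zero_le h2
    have h3 := hT _ _ (hpos m)
    rw [← hm, h1] at h3
    exact h3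
  -- the largest index at which the backward extension of `f` conflicts with `α`
  obtain ⟨m, hm, hmax⟩ := Int.exists_greatest_of_bdd
    (P := fun k => α (f k).1 ≠ some (f k).2) ⟨0, fun k hk => by
      by_contra hlt
      obtain ⟨m, rfl⟩ := Int.eq_ofNat_of_zero_le (show 0 ≤ k by omega)
      exact hk (hpos m)⟩ hneg
  have hagree : ∀ k, m < k → α (f k).1 = some (f k).2 := by
    intro k hk
    by_contra h
    have := hmax k h
    omega
  have hm0 : m < 0 := by
    by_contra hlt
    obtain ⟨m', rfl⟩ := Int.eq_ofNat_of_zero_le (show 0 ≤ m by omega)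
    exact hm (hpos m')
  have hbind : ∀ k, m < k → bindsIn α (f k).1 (f (k + 1)).1 := fun k hk =>
    ⟨_, _, hagree k hk, hagree _ (by omega), hint k⟩
  have hbind' : ∀ k, m < k → bindsIn α (f (k + 1)).1 (f k).1 := fun k hk =>
    bindsIn_symm (hbind k hk)
  have hmβ : (f m).1 ∈ adom β := by
    by_contra hmβ
    have hB := hBβ.union_chain huniq hT (fun i => (f (0 - i)).1) (0 - (m + 1)).toNat
      (by simpa using h0D) (fun i hi => by
        have := hbind' (0 - (i + 1 : ℕ)) (by omega)
        rwa [show (0 - ((i + 1 : ℕ) : ℤ)) + 1 = 0 - i by push_cast; ring] at this)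
    refine hm (hB.attach huniq (p := (f m).1) (q := (f (m + 1)).1) ?_
      (Or.inr ⟨(0 - (m + 1)).toNat, le_rfl, ?_⟩) (hfT m) (hagree _ (by omega)) (hint m)).1
    · rintro (h | ⟨i, hi, h⟩)
      · exact hmβ h
      · have := hinj h
        omega
    · rw [show (0 : ℤ) - ((0 - (m + 1)).toNat : ℤ) = m + 1 by omega]
  obtain ⟨tm, htm⟩ := mem_adom_iff.1 hmβ
  have htm' : tm ≠ (f m).2 := by
    rintro rfl
    exact hm (hβα _ _ htm)
  have hmreach := bindsIn_connected hseed hβ _ _ h0D hmβ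
  -- indices of `f` meeting `β` are bounded below
  obtain ⟨C, hC⟩ := (hfin.preimage (f := fun k => (f k).1) hinj.injOn).bddBelow
  have hv : Function.Injective fun l : ℕ => (l : ℤ) • v := by
    intro a b hab
    have h1 := hper 0 a
    have h2 := hper 0 b
    simp only at hab
    rw [hab, ← h2] at h1
    have h3 := hinj (congrArg Prod.fst h1)
    simp only [zero_add, mul_eq_mul_right_iff] at h3
    omega
  have hdisj : ∀ᶠ l : ℕ in Filter.atTop, ∀ p ∈ adom β, p + (l : ℤ) • v ∉ adom β := by
    have hfinS : (Set.image2 (fun a b : Pos => b - a) (adom β) (adom β)).Finite :=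
      hfin.image2 _ hfin
    have := hv.tendsto_cofinite.eventually hfinS.compl_mem_cofinite
    rw [Nat.cofinite_eq_atTop] at this
    filter_upwards [this] with l hl p hp hpl
    exact hl ⟨p, hp, _, hpl, by simp⟩
  obtain ⟨j₁, q₁, K₁, hq₁0, hq₁i, hq₁α, hq₁f, hq₁y⟩ := hfreq.exists
  obtain ⟨l, hl, hlj⟩ := (hdisj.and (Filter.eventually_gt_atTop (j₁ + C.natAbs))).exists
  have hln : l ≤ l * n := Nat.le_mul_of_pos_right l hn
  set w : Pos := (l : ℤ) • v with hw
  have hshift : ∀ k : ℤ, f (k + (l * n : ℕ)) = tTile (f k) w := by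
    intro k
    rw [← hper]
    push_cast
    rfl
  have hshift0 : (f (l * n : ℕ)).1 = (f 0).1 + w := by
    have := hshift 0
    rw [zero_add] at this
    rw [this]
    rfl
  have hp₀ : α ((f 0).1 + w) = β (f 0).1 := by
    rw [h0, ← hshift0, hpos]
    have := hshift 0
    rw [zero_add] at this
    rw [this]
    rfl
  obtain ⟨x, hxβ, hxne, hx⟩ := exists_forced_conflict huniq hT hβT w (f 0).1 (f m).1 hp₀ hmreach
    (by
      have h1 : α (f (m + (l * n : ℕ))).1 = some (f (m + (l * n : ℕ))).2 := by
        apply hagree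
        omega
      rw [hshift] at h1
      simp only [tTile] at h1
      rw [h1, htm]
      intro h
      exact htm' (Option.some.inj h).symm)
  -- the conflict is on `f`
  have hBpump : ∀ N : ℕ, Built T σ (adom β ∪ {p | ∃ i ≤ N, p = (f (i : ℕ)).1}) := fun N =>
    hBβ.union_chain huniq hT (fun i => (f i).1) N (by simpa using h0D) (fun i hi => by
      have := hbind i (by omega)
      push_cast
      exact this)
  obtain ⟨i, hi, hxi⟩ : ∃ i ≤ l * n, x + w = (f (i : ℕ)).1 := by
    rcases hx _ (hBpump (l * n)) (Or.inr ⟨l * n, le_rfl, hshift0.symm⟩) with h | h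
    · exact absurd h (hl x hxβ)
    · exact h
  have hxf : x = (f (i - (l * n : ℕ))).1 := by
    have := hshift (i - (l * n : ℕ))
    rw [sub_add_cancel] at this
    rw [this] at hxi
    exact add_right_cancel hxi
  have hilt : i < l * n := by
    rcases hi.lt_or_eq with h | h
    · exact h
    · exfalso
      apply hxne
      rw [hxf, h, sub_self]
      exact hp₀
  have hCi : C ≤ (i : ℤ) - (l * n : ℕ) := hC (by
    change (f (i - (l * n : ℕ))).1 ∈ adom β
    rwa [← hxf])
  have hj₁i : j₁ < i := by omega
  -- reach `f (l * n)` without using `f i`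
  obtain ⟨j₂, ⟨q₂, K₂, hq₂0, hq₂i, hq₂α, hq₂f, hq₂y⟩, hj₂⟩ :=
    (hfreq.and_eventually (Filter.eventually_gt_atTop (l * n))).exists
  have hB1 := hBpump j₁
  have hB2 := hB1.union_chain huniq hT (fun k => (q₁ k).1) K₁
    (Or.inr ⟨j₁, le_rfl, by rw [hq₁0]⟩)
    (fun k hk => ⟨_, _, hq₁α k (by omega), hq₁α _ (by omega), hq₁i k hk⟩)
  have hB3 := hB2.union_chain huniq hT (fun k => (q₂ (K₂ - k)).1) K₂
    (Or.inr ⟨K₁, le_rfl, by rw [hq₁y, Nat.sub_zero, hq₂y]⟩)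
    (fun k hk => by
      have := hq₂i (K₂ - (k + 1)) (by omega)
      rw [show K₂ - (k + 1) + 1 = K₂ - k by omega] at this
      exact ⟨_, _, hq₂α _ (by omega), hq₂α _ (by omega), interact_symm this⟩)
  have hB4 := hB3.union_chain huniq hT (fun k => (f (j₂ - (k : ℕ))).1) (j₂ - (i + 1))
    (Or.inr ⟨K₂, le_rfl, by simp [hq₂0]⟩)
    (fun k hk => by
      have := hbind' (j₂ - (k + 1 : ℕ)) (by omega)
      rwa [show ((j₂ : ℤ) - (k + 1 : ℕ)) + 1 = j₂ - k by push_cast; ring] at this)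
  have hmem := hx _ hB4 (Or.inr ⟨j₂ - l * n, by omega, by
    rw [← hshift0]
    congr 2
    omega⟩)
  rw [hxi] at hmem
  rcases hmem with (((h | ⟨k, hk, h⟩) | ⟨k, hk, h⟩) | ⟨k, hk, h⟩) | ⟨k, hk, h⟩
  · rw [← hxi] at h
    exact hl x hxβ h
  · have := hinj h
    omega
  · have := hq₁f k hk i h.symm
    omega
  · have := hq₂f _ (Nat.sub_le _ _) i h.symm
    omega
  · have := hinj h
    omega

theorem pumpTile_add (P : List Tile) (hP : 2 ≤ P.length) (k l : ℤ) :
    pumpTile P (k + l * (P.length - 1 : ℕ)) = tTile (pumpTile P k) (l • pathVec P) := by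
  have h : ((P.length - 1 : ℕ) : ℤ) = (P.length : ℤ) - 1 := by omega
  rw [h]
  simp only [pumpTile, tTile]
  rw [Int.add_mul_emod_self_right, Int.add_mul_ediv_right _ _ (by omega), add_smul]
  simp [add_assoc]

theorem exists_natCast_eq_add_mul (k : ℤ) {n : ℕ} (hn : 0 < n) :
    ∀ᶠ l : ℕ in Filter.atTop, ∃ m : ℕ, (m : ℤ) = k + l * n := by
  filter_upwards [Filter.eventually_ge_atTop k.natAbs] with l hl
  have : (l : ℤ) * 1 ≤ l * n := by
    apply mul_le_mul_of_nonneg_left <;> omega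
  exact ⟨(k + l * n).toNat, by omega⟩

theorem isBiPath_bipump (P : List Tile) (hP : 2 ≤ P.length) (h : IsInfPath (pump P)) :
    IsBiPath (bipump P) := by
  have hn : 0 < P.length - 1 := by omega
  constructor
  · intro k
    obtain ⟨l, m, hm⟩ := (exists_natCast_eq_add_mul k hn).exists
    have h1 := interact_translate (-((l : ℤ) • pathVec P)) (h.1 m)
    simp only [pump] at h1
    push_cast at h1
    rw [hm, show k + (l : ℤ) * (P.length - 1 : ℕ) + 1 = (k + 1) + l * (P.length - 1 : ℕ) by ring,
      pumpTile_add P hP, pumpTile_add P hP] at h1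
    simpa [tTile, bipump] using h1
  · intro a b hab
    obtain ⟨l, ⟨m, hm⟩, m', hm'⟩ :=
      ((exists_natCast_eq_add_mul a hn).and (exists_natCast_eq_add_mul b hn)).exists
    have : m = m' := by
      apply h.2
      simp only [pump]
      rw [hm, hm', pumpTile_add P hP, pumpTile_add P hP]
      simp only [tTile]
      simp only [bipump] at hab
      rw [hab]
    omega

theorem nth_eq_getElem {Q : List Tile} {k : ℕ} (hk : k < Q.length) : nth Q k = Q[k] := by
  simp [nth, hk]

/-- Let `P ∈ P[α]` be a simply pumpable path of a directed tile
assembly system with unique terminal assembly `α`, and let `β` be a finite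
producible assembly containing the tile `P₀`. Then there exists an index `i` such
that every path (over tile types of `T`) growing on `pump P` at an index `j ≥ i`
belongs to `P[α]`. -/
theorem eventually_growth_in_terminal
    (T : Finset TileType) (σ α : Assembly)
    (hseed : SeedOk T σ) (hterm : Terminal T σ α)
    (huniq : ∀ β, Terminal T σ β → β = α)
    (P : List Tile) (hP : PathIn α P) (hsp : SimplyPumpable α P)
    (β : Assembly) (hβ : Producible T σ β) (hfin : (adom β).Finite)
    (h0 : β (nth P 0).1 = some (nth P 0).2) :
    ∃ i : ℕ, ∀ (Q : List Tile) (j : ℕ), i ≤ j → (∀ a ∈ Q, a.2 ∈ T) →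
      GrowsOnPump Q (pump P) j → PathIn α Q := by
  obtain ⟨⟨⟨hlen, hgood⟩, hinf, hpos⟩, hnot⟩ := hsp
  have hbi := isBiPath_bipump P hlen hinf
  have hT : ∀ p t, α p = some t → t ∈ T := fun p t h => hterm.1.mem_tileset hseed h
  have hβ' := hβ.reflTransGen_of_finite hfin
  have hBβ : Built T σ (adom β) := ⟨β, hβ', rfl⟩
  have hneg : ∃ k : ℤ, α (bipump P k).1 ≠ some (bipump P k).2 := by
    by_contra h
    push Not at h
    exact hnot ⟨⟨hlen, hgood⟩, hbi, h⟩
  have hz : bipump P 0 = nth P 0 := by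
    simp [bipump, pumpTile, tTile]
  have h0' : β (bipump P 0).1 = some (bipump P 0).2 := by rwa [hz]
  have hnofreq : ∀ y, ∀ᶠ j in Filter.atTop, ¬ Returns α (bipump P) y j := by
    intro y
    rw [← Filter.not_frequently]
    exact not_frequently_returns hseed huniq hT hβ' hfin (bipump P) (P.length - 1) (by omega)
      (pathVec P) (fun k l => pumpTile_add P hlen k l) hbi.1 hbi.2 hpos hneg h0' y
  have hnear : (Set.image2 (fun a b : Pos => a + b) (adom β)
      (Set.Icc (-1) 1 ×ˢ Set.Icc (-1) 1)).Finite :=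
    hfin.image2 _ ((Set.finite_Icc _ _).prod (Set.finite_Icc _ _))
  obtain ⟨i, hi⟩ := Filter.eventually_atTop.1
    ((Filter.eventually_all_finite hnear).2 fun y _ => hnofreq y)
  refine ⟨i, fun Q j hij hQT hQ => ?_⟩
  obtain ⟨⟨hQne, hQchain, hQnodup⟩, hQ0, hQf⟩ := hQ
  refine ⟨⟨hQne, hQchain, hQnodup⟩, ?_⟩
  have hQint : ∀ k, k + 1 < Q.length → interact (nth Q k) (nth Q (k + 1)) := by
    intro k hk
    rw [nth_eq_getElem hk, nth_eq_getElem (by omega)]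
    exact List.isChain_iff_getElem.1 hQchain k hk
  suffices H : ∀ k, k < Q.length → α (nth Q k).1 = some (nth Q k).2 by
    intro a ha
    obtain ⟨k, hk, rfl⟩ := List.getElem_of_mem ha
    have := H k hk
    rwa [nth_eq_getElem hk] at this
  intro k
  induction k using Nat.strong_induction_on with
  | _ k ih =>
  intro hk
  rcases k with _ | K
  · rw [hQ0]
    exact hpos j
  have hbindQ : ∀ k < K, bindsIn α (nth Q k).1 (nth Q (k + 1)).1 := fun k hkK =>
    ⟨_, _, ih k (by omega) (by omega), ih (k + 1) (by omega) (by omega), hQint k (by omega)⟩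
  have hB1 := hBβ.union_chain huniq hT (fun i => (pump P i).1) j
    (mem_adom_iff.2 ⟨_, h0'⟩) (fun i _ => ⟨_, _, hpos i, hpos (i + 1), hinf.1 i⟩)
  have hB2 := hB1.union_chain huniq hT (fun k => (nth Q k).1) K
    (Or.inr ⟨j, le_rfl, by rw [hQ0]⟩) hbindQ
  by_cases hmem : (nth Q (K + 1)).1 ∈ adom β
  · exfalso
    refine hi j hij (nth Q K).1 ⟨_, hmem, _, interact_sub_mem (hQint K hk), by simp⟩
      ⟨nth Q, K, hQ0, fun k hkK => hQint k (by omega), fun k hkK => ih k (by omega) (by omega),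
        fun k hkK m hm => (hQf k m (by omega) hm).2, rfl⟩
  · refine (hB2.attach huniq (p := (nth Q (K + 1)).1) (t := (nth Q (K + 1)).2) ?_
      (Or.inr ⟨K, le_rfl, rfl⟩) (hQT _ ?_)
      (ih K (by omega) (by omega)) (interact_symm (hQint K hk))).1
    · rintro ((h | ⟨m, hm, h⟩) | ⟨m, hm, h⟩)
      · exact hmem h
      · have := (hQf (K + 1) m hk h).1
        omega
      · rw [nth_eq_getElem hk, nth_eq_getElem (by omega)] at h
        have := (List.Nodup.getElem_inj_iff hQnodup (i := K + 1) (j := m)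
          (hi := by simpa using hk) (hj := by simp; omega)).1 (by simpa using h)
        omega
    · rw [nth_eq_getElem hk]
      exact List.getElem_mem hk
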